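/- Let n ≥ 1. For every k ≥ 4n+2 and all homogeneous matrices X₁, …, X_k ∈ osp(1,2n), one has 𝒜_k(X₁,…,X_k) = 0. -/

import Mathlib

open Matrix

/-- Index type for the ℤ₂-graded space ℂ^p ⊕ ℂ^q. -/
abbrev Idx (p q : ℕ) := Sum (Fin p) (Fin q)

/-- Parity of a basis index. -/
def ipar {p q : ℕ} : Idx p q → ZMod 2
  | Sum.inl _ => 0
  | Sum.inr _ => 1

/-- `(-1)^a` for `a : ZMod 2`. -/
noncomputable def sgn (a : ZMod 2) : ℂ := if a = 1 then -1 else 1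

/-- A matrix is homogeneous of parity `ε` iff it maps the graded piece of
parity `a` into the piece of parity `a + ε`; equivalently, its entry `X i j`
vanishes unless `ipar i = ipar j + ε`. -/
def HasParity {p q : ℕ} (X : Matrix (Idx p q) (Idx p q) ℂ) (ε : ZMod 2) : Prop :=
  ∀ i j, ipar i ≠ ipar j + ε → X i j = 0

/-- A vector is homogeneous of parity `ε`. -/
def VHasParity {p q : ℕ} (u : Idx p q → ℂ) (ε : ZMod 2) : Prop :=
  ∀ i, ipar i ≠ ε → u i = 0

/-- The super sign `ε(σ, 𝒳) = (-1)^{K(σ,𝒳)}`, where `K(σ,𝒳)` is the number of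
pairs `(i,j)` with `i < j`, `σ i > σ j` and both `X (σ i)`, `X (σ j)` odd
(here only the parities `px` of the `X`'s matter). -/
noncomputable def superSign {k : ℕ} (σ : Equiv.Perm (Fin k)) (px : Fin k → ZMod 2) : ℂ :=
  (-1 : ℂ) ^ (Finset.univ.filter (fun ij : Fin k × Fin k =>
      ij.1 < ij.2 ∧ σ ij.2 < σ ij.1 ∧ px (σ ij.1) = 1 ∧ px (σ ij.2) = 1)).card

/-- The ordered matrix product `X (σ 0) * X (σ 1) * ⋯ * X (σ (k-1))`. -/
noncomputable def permProd {k p q : ℕ} (σ : Equiv.Perm (Fin k))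
    (X : Fin k → Matrix (Idx p q) (Idx p q) ℂ) : Matrix (Idx p q) (Idx p q) ℂ :=
  (List.ofFn fun i => X (σ i)).prod

/-- The standard supersymmetric super polynomial `𝒫_k`. -/
noncomputable def symPoly {k p q : ℕ} (X : Fin k → Matrix (Idx p q) (Idx p q) ℂ)
    (px : Fin k → ZMod 2) : Matrix (Idx p q) (Idx p q) ℂ :=
  ∑ σ : Equiv.Perm (Fin k), superSign σ px • permProd σ X

/-- The standard skew supersymmetric super polynomial `𝒜_k`. -/
noncomputable def skewPoly {k p q : ℕ} (X : Fin k → Matrix (Idx p q) (Idx p q) ℂ)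
    (px : Fin k → ZMod 2) : Matrix (Idx p q) (Idx p q) ℂ :=
  ∑ σ : Equiv.Perm (Fin k),
    (((Equiv.Perm.sign σ : ℤ) : ℂ) * superSign σ px) • permProd σ X

/-- The supertrace `str X = tr A - tr D` of a matrix in `gl(p,q)`. -/
noncomputable def strace {p q : ℕ} (X : Matrix (Idx p q) (Idx p q) ℂ) : ℂ :=
  ∑ i : Fin p, X (Sum.inl i) (Sum.inl i) - ∑ j : Fin q, X (Sum.inr j) (Sum.inr j)

/-- The super bracket `[A,B] = AB - (-1)^{|A||B|} BA` of homogeneous matrices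
`A`, `B` of parities `a`, `b`. -/
noncomputable def sbr {p q : ℕ} (A : Matrix (Idx p q) (Idx p q) ℂ) (a : ZMod 2)
    (B : Matrix (Idx p q) (Idx p q) ℂ) (b : ZMod 2) : Matrix (Idx p q) (Idx p q) ℂ :=
  A * B - sgn (a * b) • (B * A)

/-- The matrix of the even bilinear form `B` on `ℂ ⊕ ℂ^{2n}`: it is `1` on the
even line, `0` between the even and odd parts, and the standard symplectic form
with matrix `[[0, Iₙ],[-Iₙ, 0]]` on `ℂ^{2n}`. -/
noncomputable def Bmat (n : ℕ) : Matrix (Idx 1 (2*n)) (Idx 1 (2*n)) ℂ :=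
  fun i j => match i, j with
  | Sum.inl _, Sum.inl _ => 1
  | Sum.inl _, Sum.inr _ => 0
  | Sum.inr _, Sum.inl _ => 0
  | Sum.inr a, Sum.inr b =>
      if a.val + n = b.val then 1 else if b.val + n = a.val then -1 else 0

/-- The bilinear form `B(u,v)` on `ℂ ⊕ ℂ^{2n}`. -/
noncomputable def Bform (n : ℕ) (u v : Idx 1 (2*n) → ℂ) : ℂ :=
  ∑ i, ∑ j, u i * Bmat n i j * v j

/-- `X` is a homogeneous element of `osp(1,2n)` of parity `ε`:
`B(Xu,v) + (-1)^{|X||u|} B(u,Xv) = 0` for all homogeneous `u`, `v`. -/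
def ospMem {n : ℕ} (X : Matrix (Idx 1 (2*n)) (Idx 1 (2*n)) ℂ) (ε : ZMod 2) : Prop :=
  HasParity X ε ∧
  ∀ (u v : Idx 1 (2*n) → ℂ) (εu εv : ZMod 2), VHasParity u εu → VHasParity v εv →
    Bform n (X.mulVec u) v + sgn (ε * εu) * Bform n u (X.mulVec v) = 0

section Newton

variable {m K : Type*} [Fintype m] [DecidableEq m] [CommRing K]

open Polynomial in
theorem derivative_charpoly_eq_trace_adjugate (N : Matrix m m K) :
    derivative N.charpoly = (adjugate (charmatrix N)).trace := by
  have hentry : ∀ i j, derivative (charmatrix N i j) = if i = j then 1 else 0 := by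
    intro i j
    by_cases h : i = j
    · subst h; simp
    · simp [h]
  rw [Matrix.charpoly, Matrix.det_apply', Matrix.trace, derivative_sum]
  simp_rw [diag_apply, adjugate_apply, Matrix.det_apply']
  rw [Finset.sum_comm]
  refine Finset.sum_congr rfl fun σ _ => ?_
  rw [derivative_intCast_mul, derivative_prod_finset, Finset.mul_sum]
  rw [← Equiv.sum_comp σ.symm]
  refine Finset.sum_congr rfl fun i _ => ?_
  congr 1
  rw [hentry]
  rw [← Finset.mul_prod_erase _ _ (Finset.mem_univ (σ.symm i))]
  rw [mul_comm]
  congr 1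
  · by_cases h : i = σ.symm i
    · rw [← h, (Equiv.eq_symm_apply σ).1 h]
      simp
    · simp [Pi.single_apply, updateRow_apply]
      grind
  · refine Finset.prod_congr rfl fun a ha => ?_
    rw [updateRow_ne]
    rintro h
    apply Finset.ne_of_mem_erase ha
    simp [← h]

open Polynomial in
theorem charpoly_newton (N : Matrix m m K) (i : ℕ) (hi : i ≤ Fintype.card m) :
    ((Fintype.card m - i : ℕ) : K) * N.charpoly.coeff i
      + ∑ l ∈ Finset.range (Fintype.card m - i),
          N.charpoly.coeff (i + 1 + l) * (N ^ (l + 1)).trace = 0 := by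
  set B := matPolyEquiv (adjugate (charmatrix N)) with hB
  have hrec : ∀ j, B.coeff j = N.charpoly.coeff (j + 1) • 1 + N * B.coeff (j + 1) := by
    intro j
    have h := congrArg matPolyEquiv (mul_adjugate (charmatrix N))
    rw [map_mul, matPolyEquiv_charmatrix, ← hB] at h
    have h2 := congrArg (fun p => p.coeff (j + 1)) h
    simp only [sub_mul, coeff_sub, coeff_X_mul, coeff_C_mul] at h2
    rw [sub_eq_iff_eq_add] at h2
    rw [h2]
    congr 1
    ext a b
    rw [matPolyEquiv_coeff_apply]
    simp only [Matrix.smul_apply, Matrix.one_apply, smul_eq_mul]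
    change (N.charpoly * _).coeff _ = _
    by_cases hab : a = b <;> simp [hab]

  have hexp : ∀ d j, B.natDegree + 1 ≤ j + d →
      B.coeff j = ∑ l ∈ Finset.range d, N.charpoly.coeff (j + 1 + l) • N ^ l := by
    intro d
    induction d with
    | zero => intro j hj; simpa using coeff_eq_zero_of_natDegree_lt (by omega)
    | succ d ih =>
      intro j hj
      rw [hrec, ih (j + 1) (by omega), Finset.sum_range_succ', add_comm, Finset.mul_sum]
      congr 1
      · refine Finset.sum_congr rfl fun l _ => ?_
        rw [mul_smul_comm, pow_succ', show j + 1 + 1 + l = j + 1 + (l + 1) by omega]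
  have htr : ∀ j, (B.coeff j).trace = (j + 1 : K) * N.charpoly.coeff (j + 1) := by
    intro j
    have := congrArg (fun p => p.coeff j) (derivative_charpoly_eq_trace_adjugate N)
    simp only [coeff_derivative] at this
    rw [mul_comm, this]
    simp [Matrix.trace, hB, matPolyEquiv_coeff_apply]
  have htop : ∀ j, Fintype.card m < j → N.charpoly.coeff j = 0 := by
    intro j hj
    nontriviality K
    exact coeff_eq_zero_of_natDegree_lt (by rwa [charpoly_natDegree_eq_dim])
  have key : (i : K) * N.charpoly.coeff i = ∑ l ∈ Finset.range (Fintype.card m - i + 1),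
      N.charpoly.coeff (i + l) * (N ^ l).trace := by
    cases i with
    | zero =>
      have h := congrArg Matrix.trace (aeval_self_charpoly N)
      rw [aeval_eq_sum_range, trace_zero, trace_sum] at h
      rw [Nat.cast_zero, zero_mul, ← h]
      nontriviality K
      rw [charpoly_natDegree_eq_dim]
      simp
    | succ j =>
      have := htr j
      rw [hexp (B.natDegree + 1 + (Fintype.card m - (j + 1) + 1)) j (by omega), trace_sum] at this
      rw [Nat.cast_succ, ← this]
      rw [add_comm (B.natDegree + 1), Finset.sum_range_add]
      simp only [trace_smul, smul_eq_mul]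
      rw [add_eq_left]
      refine Finset.sum_eq_zero fun l _ => ?_
      rw [htop _ (by omega), zero_mul]
  rw [Finset.sum_range_succ'] at key
  rw [Nat.cast_sub hi]
  simp only [pow_zero, trace_one, add_zero] at key
  have e : ∀ l, i + 1 + l = i + (l + 1) := by intro l; omega
  simp only [e]
  linear_combination (-1 : K) * key
end Newton

section SchurComplement

variable {o m K C : Type*} [Fintype o] [Fintype m] [DecidableEq m]
  [CommRing K] [Ring C] [Algebra K C]

theorem fromCols_mul_fromBlocks_intertwine {S T P : Matrix m m K} {U : Matrix o m C}
    {W : Matrix m o C} (hST : S * T = 1) (hP : W * U = P.map (algebraMap K C))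
    (hUTW : U * (T.map (algebraMap K C) * W) = 0) :
    fromCols (T.map (algebraMap K C) * W) (1 : Matrix m m C) * fromBlocks 0 U W (S.map (algebraMap K C)) =
      (S + T * P).map (algebraMap K C) * fromCols (T.map (algebraMap K C) * W) (1 : Matrix m m C) := by
  have h1 : (S + T * P).map (algebraMap K C) =
      S.map (algebraMap K C) + T.map (algebraMap K C) * (W * U) := by
    rw [hP, ← Matrix.map_mul, ← Matrix.map_add _ (map_add _)]
  have h2 : S.map (algebraMap K C) * T.map (algebraMap K C) = 1 := by
    rw [← Matrix.map_mul, hST, Matrix.map_one _ (map_zero _) (map_one _)]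
  rw [h1, fromCols_mul_fromBlocks, mul_fromCols, Matrix.mul_one]
  congr 1
  · rw [Matrix.add_mul, ← Matrix.mul_assoc (S.map _), h2, Matrix.mul_assoc (T.map _) (W * U),
      Matrix.mul_assoc W, hUTW]
    simp
  · rw [Matrix.one_mul, Matrix.mul_assoc, add_comm]

theorem fromBlocks_mul_fromRows_mul_fromCols {S T : Matrix m m K} {U : Matrix o m C}
    {W : Matrix m o C} (hST : S * T = 1)
    (hUTW : U * (T.map (algebraMap K C) * W) = 0) :
    fromBlocks 0 U W (S.map (algebraMap K C)) *
      (fromRows (0 : Matrix o m C) (1 : Matrix m m C) * fromCols (T.map (algebraMap K C) * W) (1 : Matrix m m C)) =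
    fromBlocks 0 U W (S.map (algebraMap K C)) := by
  have h2 : S.map (algebraMap K C) * T.map (algebraMap K C) = 1 := by
    rw [← Matrix.map_mul, hST, Matrix.map_one _ (map_zero _) (map_one _)]
  have h3 : S.map (algebraMap K C) * (T.map (algebraMap K C) * W) = W := by
    rw [← Matrix.mul_assoc, h2, Matrix.one_mul]
  rw [fromRows_mul_fromCols, fromBlocks_multiply]
  simp [h3, hUTW]

theorem pow_intertwine {r : Type*} [Fintype r] [DecidableEq r] {M : Matrix r r C}
    {N : Matrix m m K} {Q : Matrix m r C} (h : Q * M = N.map (algebraMap K C) * Q) (j : ℕ) :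
    Q * M ^ j = (N ^ j).map (algebraMap K C) * Q := by
  induction j with
  | zero => simp
  | succ j ih =>
    rw [pow_succ, ← Matrix.mul_assoc, ih, Matrix.mul_assoc, h, ← Matrix.mul_assoc,
      ← Matrix.map_mul, pow_succ]

theorem mul_aeval_intertwine {r : Type*} [Fintype r] [DecidableEq r] {M : Matrix r r C}
    {N : Matrix m m K} {Q : Matrix m r C} (h : Q * M = N.map (algebraMap K C) * Q)
    (p : Polynomial K) :
    Q * Polynomial.aeval M p = (Polynomial.aeval N p).map (algebraMap K C) * Q := by
  induction p using Polynomial.induction_on' with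
  | add p q hp hq =>
    rw [map_add, map_add, Matrix.mul_add, hp, hq, Matrix.map_add _ (map_add _), Matrix.add_mul]
  | monomial i a =>
    have hmap : (a • N ^ i).map (algebraMap K C) = a • (N ^ i).map (algebraMap K C) := by
      ext b c
      rw [Matrix.map_apply, Matrix.smul_apply, Matrix.smul_apply, smul_eq_mul, map_mul,
        Matrix.map_apply, Algebra.smul_def]
    rw [Polynomial.aeval_monomial, Polynomial.aeval_monomial, ← Algebra.smul_def,
      ← Algebra.smul_def, Matrix.mul_smul, pow_intertwine h, ← Matrix.smul_mul, hmap]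

theorem fromBlocks_mul_aeval_charpoly [DecidableEq o] {S T P : Matrix m m K} {U : Matrix o m C}
    {W : Matrix m o C} (hST : S * T = 1) (hP : W * U = P.map (algebraMap K C))
    (hUTW : U * (T.map (algebraMap K C) * W) = 0) :
    fromBlocks 0 U W (S.map (algebraMap K C)) *
      Polynomial.aeval (fromBlocks 0 U W (S.map (algebraMap K C))) (S + T * P).charpoly = 0 := by
  nth_rw 1 [← fromBlocks_mul_fromRows_mul_fromCols hST hUTW]
  rw [Matrix.mul_assoc, Matrix.mul_assoc (fromRows _ _),
    mul_aeval_intertwine (fromCols_mul_fromBlocks_intertwine hST hP hUTW),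
    aeval_self_charpoly]
  simp

theorem trace_pow_schurComplement [DecidableEq o] {S T P : Matrix m m K} {U : Matrix o m C}
    {W : Matrix m o C} (hST : S * T = 1) (hP : W * U = P.map (algebraMap K C))
    (hUTW : U * (T.map (algebraMap K C) * W) = 0) (j : ℕ)
    (hW : ∀ i a b l, (fromBlocks 0 U W (S.map (algebraMap K C)) ^ (j + 1)) (Sum.inl a) (Sum.inr i)
        * W l b = - (W l b * (fromBlocks 0 U W (S.map (algebraMap K C)) ^ (j + 1))
          (Sum.inl a) (Sum.inr i))) :
    algebraMap K C ((S + T * P) ^ (j + 1)).trace =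
      (fromBlocks 0 U W (S.map (algebraMap K C)) ^ (j + 1)).toBlocks₂₂.trace
      - (fromBlocks 0 U W (S.map (algebraMap K C)) ^ (j + 1)).toBlocks₁₁.trace := by
  set M := fromBlocks 0 U W (S.map (algebraMap K C)) with hM
  set Y := T.map (algebraMap K C) * W with hY
  set Z₁ := (M ^ (j + 1)).toBlocks₁₂
  set Z₂ := (M ^ (j + 1)).toBlocks₂₂
  have hZ : M ^ (j + 1) * fromRows (0 : Matrix o m C) (1 : Matrix m m C) = fromRows Z₁ Z₂ := by
    conv_lhs => rw [← fromBlocks_toBlocks (M ^ (j + 1)), fromBlocks_mul_fromRows]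
    simp [Z₁, Z₂]
  have hMZ : M ^ (j + 1) = fromBlocks (Z₁ * Y) Z₁ (Z₂ * Y) Z₂ := by
    have : M ^ (j + 1) = M ^ (j + 1) * fromRows (0 : Matrix o m C) (1 : Matrix m m C) * fromCols Y (1 : Matrix m m C) := by
      rw [pow_succ, Matrix.mul_assoc, Matrix.mul_assoc,
        fromBlocks_mul_fromRows_mul_fromCols hST hUTW]
    rw [this, hZ, fromRows_mul_fromCols]
    simp
  have hS : ((S + T * P) ^ (j + 1)).map (algebraMap K C) = Y * Z₁ + Z₂ := by
    have := pow_intertwine (fromCols_mul_fromBlocks_intertwine hST hP hUTW) (j + 1)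
    have h2 := congrArg (· * (fromRows (0 : Matrix o m C) (1 : Matrix m m C) : Matrix (o ⊕ m) m C)) this
    simp only [Matrix.mul_assoc] at h2
    rw [← hM, ← hY, hZ, fromCols_mul_fromRows, fromCols_mul_fromRows] at h2
    simpa using h2.symm
  have hanti : (Y * Z₁).trace = - (Z₁ * Y).trace := by
    simp only [Matrix.trace, diag_apply, Matrix.mul_apply (M := Y), Matrix.mul_apply (M := Z₁)]
    rw [Finset.sum_comm, ← Finset.sum_neg_distrib]
    refine Finset.sum_congr rfl fun a _ => ?_
    rw [← Finset.sum_neg_distrib]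
    refine Finset.sum_congr rfl fun i _ => ?_
    simp only [hY, Matrix.mul_apply, Finset.sum_mul, Finset.mul_sum, ← Finset.sum_neg_distrib]
    refine Finset.sum_congr rfl fun l _ => ?_
    have h : Z₁ a i * W l a = - (W l a * Z₁ a i) := hW i a a l
    rw [Matrix.map_apply, ← mul_assoc, ← Algebra.commutes, mul_assoc, mul_assoc, h, mul_neg,
      neg_neg]
  have : algebraMap K C ((S + T * P) ^ (j + 1)).trace =
      (((S + T * P) ^ (j + 1)).map (algebraMap K C)).trace := by
    simp [Matrix.trace]
  rw [this, hS, trace_add, hanti, hMZ]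
  simp
  abel

end SchurComplement

section Continuity

variable {m r K C : Type*} [Fintype m] [DecidableEq m] [Fintype r] [DecidableEq r]
  [CommRing K] [Ring C] [Algebra K C] [Algebra ℂ K] [Algebra ℂ C] [IsScalarTower ℂ K C]
  [TopologicalSpace C] [IsTopologicalRing C]

theorem exists_continuous_charpoly_coeff (N : ℂ → Matrix m m K) (p : ℕ → ℂ → C)
    (hpc : ∀ j, Continuous (p j)) (hp0 : ∀ j, p j 0 = 0)
    (hp : ∀ t, t ≠ 0 → ∀ j, p j t = algebraMap K C (N t ^ (j + 1)).trace) (d : ℕ)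
    (hd : d ≤ Fintype.card m) :
    ∃ f : ℂ → C, Continuous f ∧ (f 0 = if d = 0 then 1 else 0) ∧
      ∀ t, t ≠ 0 → f t = algebraMap K C ((N t).charpoly.coeff (Fintype.card m - d)) := by
  induction d using Nat.strong_induction_on with
  | _ d ih =>
    rcases Nat.eq_zero_or_pos d with rfl | hpos
    · refine ⟨fun _ => 1, continuous_const, by simp, fun t _ => ?_⟩
      cases subsingleton_or_nontrivial K
      · have := Module.subsingleton K C
        exact Subsingleton.elim _ _
      have := (charpoly_monic (N t)).coeff_natDegree
      rw [charpoly_natDegree_eq_dim] at this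
      simp [this]
    · choose! f hfc hf0 hf using fun l (hl : l < d) => ih l hl (by omega)
      refine ⟨fun t => algebraMap ℂ C (-(d : ℂ)⁻¹) *
        ∑ l ∈ Finset.range d, f (d - 1 - l) t * p l t, ?_, ?_, ?_⟩
      · refine continuous_const.mul (continuous_finsetSum _ fun l hl => ?_)
        exact (hfc _ (by omega)).mul (hpc l)
      · simp [hp0, hpos.ne']
      · intro t ht
        have h := charpoly_newton (N t) (Fintype.card m - d) (by omega)
        rw [Nat.sub_sub_self hd] at h
        have h2 : (N t).charpoly.coeff (Fintype.card m - d) =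
            algebraMap ℂ K (-(d : ℂ)⁻¹) * ∑ l ∈ Finset.range d,
              (N t).charpoly.coeff (Fintype.card m - d + 1 + l) * (N t ^ (l + 1)).trace := by
          have hd' : algebraMap ℂ K (d : ℂ)⁻¹ * (d : K) = 1 := by
            rw [← map_natCast (algebraMap ℂ K), ← map_mul, inv_mul_cancel₀, map_one]
            exact_mod_cast hpos.ne'
          rw [map_neg]
          linear_combination (algebraMap ℂ K (d : ℂ)⁻¹) * h
            - (N t).charpoly.coeff (Fintype.card m - d) * hd'
        rw [h2, map_mul, map_sum, ← IsScalarTower.algebraMap_apply ℂ K C]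
        refine congrArg _ (Finset.sum_congr rfl fun l hl => ?_)
        rw [Finset.mem_range] at hl
        rw [map_mul, hp t ht, hf _ (by omega) t ht]
        congr 4
        omega

theorem pow_eq_zero_of_mul_aeval_charpoly [T2Space C] {M : ℂ → Matrix r r C} (hM : Continuous M)
    (N : ℂ → Matrix m m K) (hMN : ∀ t, t ≠ 0 → M t * Polynomial.aeval (M t) (N t).charpoly = 0)
    (p : ℕ → ℂ → C) (hpc : ∀ j, Continuous (p j)) (hp0 : ∀ j, p j 0 = 0)
    (hp : ∀ t, t ≠ 0 → ∀ j, p j t = algebraMap K C (N t ^ (j + 1)).trace) :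
    M 0 ^ (Fintype.card m + 1) = 0 := by
  choose! f hfc hf0 hf using exists_continuous_charpoly_coeff N p hpc hp0 hp
  set F : ℂ → Matrix r r C := fun t =>
    M t * ∑ d ∈ Finset.range (Fintype.card m + 1), f d t • M t ^ (Fintype.card m - d) with hF
  have hFc : Continuous F := by
    refine hM.mul (continuous_finsetSum _ fun d hd => ?_)
    exact (hfc d (by simp at hd; omega)).smul (hM.pow _)
  have hF0 : F = fun _ => 0 := by
    refine Continuous.ext_on (dense_compl_singleton (0 : ℂ)) hFc continuous_const fun t ht => ?_
    rw [← hMN t ht, Polynomial.aeval_eq_sum_range]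
    simp only [hF]
    congr 1
    cases subsingleton_or_nontrivial K
    · have := Module.subsingleton K C
      ext
      exact Subsingleton.elim _ _
    rw [charpoly_natDegree_eq_dim, ← Finset.sum_range_reflect]
    refine Finset.sum_congr rfl fun d hd => ?_
    rw [Finset.mem_range] at hd
    rw [hf _ (by omega) t ht, algebraMap_smul]
    congr 2 <;> omega
  have := congrFun hF0 0
  simp only [hF] at this
  rw [Finset.sum_range_succ', Finset.sum_eq_zero, hf0 0 (by omega)] at this
  · simpa [pow_succ'] using this
  · intro d hd
    rw [Finset.mem_range] at hd
    simp [hf0 (d + 1) (by omega)]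

end Continuity

section Perturbation

theorem sum_sum_eq_zero_of_antisymm {m V : Type*} [Fintype m] [AddCommGroup V] [Module ℂ V]
    (f : m → m → V) (hf : ∀ i j, f i j = - f j i) : ∑ i, ∑ j, f i j = 0 := by
  have h : ∑ i, ∑ j, f i j = - ∑ i, ∑ j, f i j := by
    conv_lhs => rw [Finset.sum_comm]
    simp only [← Finset.sum_neg_distrib]
    exact Finset.sum_congr rfl fun i _ => Finset.sum_congr rfl fun j _ => hf j i
  have h2 : (2 : ℂ) • ∑ i, ∑ j, f i j = 0 := by
    rw [two_smul]
    nth_rw 1 [h]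
    exact neg_add_cancel _
  exact (smul_eq_zero.1 h2).resolve_left two_ne_zero

theorem isUnit_of_sub_isNilpotent {m K : Type*} [Fintype m] [DecidableEq m] [CommRing K]
    {A B : Matrix m m K} (hA : IsUnit A.det)
    (h : ∀ i j, IsNilpotent (B i j - A i j)) : IsUnit B.det := by
  have hmap : (Ideal.Quotient.mk (nilradical K)).mapMatrix B =
      (Ideal.Quotient.mk (nilradical K)).mapMatrix A := by
    ext i j
    exact Ideal.Quotient.eq.2 (mem_nilradical.2 (h i j))
  have hdet : B.det - A.det ∈ nilradical K := by
    rw [← Ideal.Quotient.eq, RingHom.map_det, RingHom.map_det, hmap]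
  simpa using (mem_nilradical.1 hdet).isUnit_add_left_of_commute hA (Commute.all _ _)

variable {o m K C : Type*} [Unique o] [Fintype m] [DecidableEq m] [CommRing K] [Ring C]
  [Algebra K C] [Algebra ℂ K] [Algebra ℂ C] [IsScalarTower ℂ K C]

theorem pow_eq_zero_of_skew [TopologicalSpace C] [IsTopologicalRing C] [ContinuousSMul ℂ C]
    [T2Space C] {S J P : Matrix m m K} {U : Matrix o m C} {W : Matrix m o C}
    (hJ : Jᵀ = -J) (hJJ : J * J = -1) (hSJ : Sᵀ * J = -(J * S))
    (hS : ∀ i j, IsNilpotent (S i j))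
    (hP : W * U = P.map (algebraMap K C)) (hU : U = -(Wᵀ * J.map (algebraMap K C)))
    (hWW : ∀ i j a b, W i a * W j b = -(W j b * W i a))
    (hMW : ∀ (t : ℂ) (k : ℕ) i a b l,
      (fromBlocks 0 U W ((S + t • J).map (algebraMap K C)) ^ k) (Sum.inl a) (Sum.inr i) * W l b =
      - (W l b * (fromBlocks 0 U W ((S + t • J).map (algebraMap K C)) ^ k)
        (Sum.inl a) (Sum.inr i)))
    (htr : ∀ k : ℕ, (fromBlocks 0 U W (S.map (algebraMap K C)) ^ (k + 1)).toBlocks₂₂.trace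
      - (fromBlocks 0 U W (S.map (algebraMap K C)) ^ (k + 1)).toBlocks₁₁.trace = 0) :
    fromBlocks 0 U W (S.map (algebraMap K C)) ^ (Fintype.card m + 1) = 0 := by
  set St : ℂ → Matrix m m K := fun t => S + t • J with hSt
  set M : ℂ → Matrix (o ⊕ m) (o ⊕ m) C :=
    fun t => fromBlocks 0 U W ((St t).map (algebraMap K C)) with hM
  have hM0 : M 0 = fromBlocks 0 U W (S.map (algebraMap K C)) := by simp [hM, hSt]
  have hMc : Continuous M := by
    refine continuous_const.matrix_fromBlocks continuous_const continuous_const ?_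
    refine continuous_matrix fun i j => ?_
    have : ∀ t : ℂ, algebraMap K C (St t i j) =
        algebraMap K C (S i j) + t • algebraMap K C (J i j) := by
      intro t
      change algebraMap K C (S i j + t • J i j) = _
      rw [map_add, Algebra.smul_def t (J i j), map_mul, ← IsScalarTower.algebraMap_apply,
        ← Algebra.smul_def]
    simp only [Matrix.map_apply, this]
    fun_prop
  have hunit : ∀ t : ℂ, t ≠ 0 → St t * (St t)⁻¹ = 1 := by
    intro t ht
    refine Matrix.mul_nonsing_inv _ (isUnit_of_sub_isNilpotent (A := t • J) ?_ fun i j => ?_)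
    · rw [← Matrix.isUnit_iff_isUnit_det]
      refine isUnit_iff_exists_inv.2 ⟨(-t⁻¹) • J, ?_⟩
      rw [Matrix.smul_mul, Matrix.mul_smul, hJJ, smul_smul]
      simp [ht]
    · simpa [hSt] using hS i j
  have hSJt : ∀ t, (St t)ᵀ * J = -(J * St t) := by
    intro t
    simp [hSt, Matrix.add_mul, Matrix.mul_add, hSJ, hJ, add_comm]
  have hUTW : ∀ t : ℂ, t ≠ 0 → U * (((St t)⁻¹).map (algebraMap K C) * W) = 0 := by
    intro t ht
    set T := (St t)⁻¹
    have hsymm : (J * T)ᵀ = J * T := by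
      have h1 : Tᵀ * (St t)ᵀ = 1 := by
        rw [← transpose_mul, hunit t ht, transpose_one]
      calc (J * T)ᵀ = -(Tᵀ * J) := by rw [transpose_mul, hJ, Matrix.mul_neg]
        _ = -(Tᵀ * (J * (St t * T))) := by rw [hunit t ht, Matrix.mul_one]
        _ = Tᵀ * ((St t)ᵀ * J) * T := by
          rw [hSJt, Matrix.mul_neg, Matrix.neg_mul]
          simp only [Matrix.mul_assoc]
        _ = J * T := by rw [← Matrix.mul_assoc Tᵀ, h1, Matrix.one_mul]
    have : U * (T.map (algebraMap K C) * W) = -(Wᵀ * ((J * T).map (algebraMap K C) * W)) := by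
      rw [hU, Matrix.map_mul, Matrix.neg_mul, Matrix.mul_assoc, Matrix.mul_assoc]
    rw [this, neg_eq_zero]
    ext a b
    obtain rfl := Subsingleton.elim a b
    simp only [Matrix.mul_apply (M := Wᵀ), Matrix.mul_apply (N := W), Finset.mul_sum]
    refine sum_sum_eq_zero_of_antisymm _ fun i j => ?_
    have h : (J * T) i j = (J * T) j i := congrFun (congrFun hsymm j) i
    simp only [transpose_apply, Matrix.map_apply]
    rw [h, ← mul_assoc, ← Algebra.commutes, mul_assoc, hWW i j, mul_neg, ← mul_assoc,
      Algebra.commutes, mul_assoc]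
  set p : ℕ → ℂ → C := fun k t => (M t ^ (k + 1)).toBlocks₂₂.trace
      - (M t ^ (k + 1)).toBlocks₁₁.trace with hp
  rw [← hM0]
  refine pow_eq_zero_of_mul_aeval_charpoly hMc (fun t => St t + (St t)⁻¹ * P) ?_ p ?_ ?_ ?_
  · intro t ht
    exact fromBlocks_mul_aeval_charpoly (hunit t ht) hP (hUTW t ht)
  · intro k
    simp only [hp, Matrix.trace, toBlocks₁₁, toBlocks₂₂, diag_apply, of_apply]
    have hc : ∀ i j, Continuous fun t => (M t ^ (k + 1)) i j :=
      fun i j => (hMc.pow _).matrix_elem i j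
    fun_prop
  · intro k
    simp only [hp, hM0, htr]
  · intro t ht k
    exact (trace_pow_schurComplement (hunit t ht) hP (hUTW t ht) k (hMW t (k + 1))).symm

end Perturbation

section Graded

theorem sgn_add (a b : ZMod 2) : sgn (a + b) = sgn a * sgn b := by
  have h : ∀ c : ZMod 2, c = 0 ∨ c = 1 := by decide
  have h2 : (1 + 1 : ZMod 2) = 0 := rfl
  rcases h a with rfl | rfl <;> rcases h b with rfl | rfl <;> simp [sgn, h2]

theorem sgn_mul_self (a : ZMod 2) : sgn a * sgn a = 1 := by
  unfold sgn; split_ifs <;> norm_num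

theorem sgn_zero : sgn 0 = 1 := by simp [sgn]

theorem sgn_one : sgn 1 = -1 := by simp [sgn]

variable {C ι : Type*} [Ring C] [Algebra ℂ C] (x : ι → C) (px : ι → ZMod 2)

/-- Elements commuting with every generator up to the sign attached to the bidegree `(p, q)`. -/
noncomputable def twistedCentralizer (p q : ZMod 2) : Submodule ℂ C where
  carrier := {y | ∀ i, y * x i = sgn (p + q * px i) • (x i * y)}
  add_mem' ha hb i := by rw [add_mul, mul_add, smul_add, ha i, hb i]
  zero_mem' i := by simp
  smul_mem' c y hy i := by rw [smul_mul_assoc, hy i, mul_smul_comm, smul_comm]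

/-- Elements that supercommute with all elements of definite bidegree. -/
noncomputable def superCentralizer (p q : ZMod 2) : Submodule ℂ C where
  carrier := {y | ∀ p' q', ∀ z ∈ twistedCentralizer x px p' q',
    y * z = sgn (p * p' + q * q') • (z * y)}
  add_mem' ha hb p' q' z hz := by rw [add_mul, mul_add, smul_add, ha p' q' z hz, hb p' q' z hz]
  zero_mem' p' q' z hz := by simp
  smul_mem' c y hy p' q' z hz := by rw [smul_mul_assoc, hy p' q' z hz, mul_smul_comm, smul_comm]

variable {x px}

theorem mul_mem_superCentralizer {p q p' q' : ZMod 2} {y z : C}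
    (hy : y ∈ superCentralizer x px p q) (hz : z ∈ superCentralizer x px p' q') :
    y * z ∈ superCentralizer x px (p + p') (q + q') := by
  intro a b w hw
  rw [mul_assoc, hz a b w hw, mul_smul_comm, ← mul_assoc, hy a b w hw, smul_mul_assoc, smul_smul,
    mul_assoc, ← sgn_add]
  congr 2
  ring

theorem algebraMap_mem_superCentralizer (c : ℂ) :
    algebraMap ℂ C c ∈ superCentralizer x px 0 0 := by
  intro p q z _
  simp [sgn_zero, Algebra.commutes]

theorem mem_superCentralizer_generator (i : ι) : x i ∈ superCentralizer x px 1 (px i) := by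
  intro p q z hz
  rw [hz i, smul_smul, ← sgn_add, one_mul, mul_comm (px i), sgn_add, sgn_mul_self, one_smul]

section Relations

variable (hx : ∀ i j, x i * x j = sgn (1 + px i * px j) • (x j * x i))

include hx in
theorem superCentralizer_le_twistedCentralizer (p q : ZMod 2) :
    superCentralizer x px p q ≤ twistedCentralizer x px p q := by
  intro y hy i
  have := hy 1 (px i) (x i) (hx i)
  rwa [mul_one] at this

include hx in
theorem supercommute {p q p' q' : ZMod 2} {y z : C}
    (hy : y ∈ superCentralizer x px p q) (hz : z ∈ superCentralizer x px p' q') :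
    y * z = sgn (p * p' + q * q') • (z * y) :=
  hy p' q' z (superCentralizer_le_twistedCentralizer hx p' q' hz)

include hx in
theorem superCentralizer_zero_zero_mem_center (hgen : Algebra.adjoin ℂ (Set.range x) = ⊤) {y : C}
    (hy : y ∈ superCentralizer x px 0 0) : y ∈ Subalgebra.center ℂ C := by
  have h : (⊤ : Subalgebra ℂ C) ≤ Subalgebra.centralizer ℂ {y} := by
    rw [← hgen, Algebra.adjoin_le_iff]
    rintro _ ⟨i, rfl⟩
    rw [SetLike.mem_coe, Subalgebra.mem_centralizer_iff]
    rintro _ rfl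
    have := supercommute hx hy (mem_superCentralizer_generator (px := px) i)
    simpa [sgn_zero] using this
  rw [Subalgebra.mem_center_iff]
  intro b
  have := (Subalgebra.mem_centralizer_iff ℂ).1 (h (Algebra.mem_top (x := b))) y rfl
  exact this.symm

include hx in
theorem transpose_mul_of_mem_superCentralizer {r s t : Type*} [Fintype s] {p q p' q' : ZMod 2}
    {M : Matrix r s C} {N : Matrix s t C} (hM : ∀ i j, M i j ∈ superCentralizer x px p q)
    (hN : ∀ i j, N i j ∈ superCentralizer x px p' q') :
    (M * N)ᵀ = sgn (p * p' + q * q') • (Nᵀ * Mᵀ) := by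
  ext i j
  simp only [transpose_apply, Matrix.mul_apply, Matrix.smul_apply, Finset.smul_sum]
  exact Finset.sum_congr rfl fun k _ => supercommute hx (hM j k) (hN k i)

end Relations

theorem matrix_mul_mem_superCentralizer {r s t : Type*} [Fintype s] {a : r → ZMod 2}
    {b : s → ZMod 2} {c : t → ZMod 2} {p p' : ZMod 2} {M : Matrix r s C} {N : Matrix s t C}
    (hM : ∀ i j, M i j ∈ superCentralizer x px p (a i + b j))
    (hN : ∀ i j, N i j ∈ superCentralizer x px p' (b i + c j)) (i : r) (j : t) :
    (M * N) i j ∈ superCentralizer x px (p + p') (a i + c j) := by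
  rw [Matrix.mul_apply]
  refine Submodule.sum_mem _ fun k _ => ?_
  have := mul_mem_superCentralizer (hM i k) (hN k j)
  have e : a i + b k + (b k + c j) = a i + c j := by
    rw [add_assoc, ← add_assoc (b k), CharTwo.add_self_eq_zero, zero_add]
  rwa [e] at this

theorem matrix_pow_mem_superCentralizer {r : Type*} [Fintype r] [DecidableEq r] {a : r → ZMod 2}
    {p : ZMod 2} {M : Matrix r r C}
    (hM : ∀ i j, M i j ∈ superCentralizer x px p (a i + a j)) (k : ℕ) (i j : r) :
    (M ^ k) i j ∈ superCentralizer x px (k * p) (a i + a j) := by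
  induction k generalizing i j with
  | zero =>
    rw [pow_zero, Matrix.one_apply]
    split_ifs with h
    · subst h
      rw [CharTwo.add_self_eq_zero, Nat.cast_zero, zero_mul, ← map_one (algebraMap ℂ C)]
      exact algebraMap_mem_superCentralizer 1
    · exact zero_mem _
  | succ k ih =>
    rw [pow_succ, Nat.cast_succ, add_one_mul]
    exact matrix_mul_mem_superCentralizer ih hM i j

theorem sum_sgn_smul_diag_mul (hx : ∀ i j, x i * x j = sgn (1 + px i * px j) • (x j * x i))
    {r : Type*} [Fintype r] {a : r → ZMod 2} {M N : Matrix r r C}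
    (hM : ∀ i j, M i j ∈ superCentralizer x px 1 (a i + a j))
    (hN : ∀ i j, N i j ∈ superCentralizer x px 1 (a i + a j)) :
    ∑ i, sgn (a i) • (M * N) i i = - ∑ i, sgn (a i) • (N * M) i i := by
  simp only [Matrix.mul_apply, Finset.smul_sum, ← Finset.sum_neg_distrib]
  rw [Finset.sum_comm]
  refine Finset.sum_congr rfl fun i _ => Finset.sum_congr rfl fun j _ => ?_
  rw [supercommute hx (hM j i) (hN i j), smul_smul, ← neg_smul, ← sgn_add, ← neg_one_mul,
    ← sgn_one, ← sgn_add]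
  congr 2
  generalize a i = u
  generalize a j = v
  revert u v
  decide

noncomputable instance centerAlgebra : Algebra (Subalgebra.center ℂ C) C where
  algebraMap := (Subalgebra.center ℂ C).val.toRingHom
  commutes' r x := ((Subalgebra.mem_center_iff.1 r.2) x).symm
  smul_def' _ _ := rfl

theorem centerAlgebra_algebraMap_injective :
    Function.Injective (algebraMap (Subalgebra.center ℂ C) C) :=
  Subtype.val_injective

theorem exists_matrix_map_center {r s : Type*} (M : Matrix r s C)
    (hM : ∀ i j, M i j ∈ Subalgebra.center ℂ C) :
    ∃ N : Matrix r s (Subalgebra.center ℂ C),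
      N.map (algebraMap (Subalgebra.center ℂ C) C) = M :=
  ⟨fun i j => ⟨M i j, hM i j⟩, rfl⟩

theorem isNilpotent_of_algebraMap_center {y : Subalgebra.center ℂ C}
    (hy : IsNilpotent (algebraMap (Subalgebra.center ℂ C) C y)) : IsNilpotent y :=
  (IsNilpotent.map_iff centerAlgebra_algebraMap_injective).1 hy

/-- A matrix of the shape of a generic element of `osp(1, m)`, with entries in a superalgebra whose
supercommutation sign is `sgn (1 + px i * px j)`, is nilpotent. -/
theorem fromBlocks_pow_eq_zero [TopologicalSpace C] [IsTopologicalRing C] [ContinuousSMul ℂ C]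
    [T2Space C] {o m : Type*} [Unique o] [Fintype m] [DecidableEq m]
    (hx : ∀ i j, x i * x j = sgn (1 + px i * px j) • (x j * x i))
    (hgen : Algebra.adjoin ℂ (Set.range x) = ⊤) (F : Submodule ℂ C)
    (hF : ∀ y ∈ F, IsNilpotent y) (hxF : ∀ i j, x i * x j ∈ F)
    {J : Matrix m m ℂ} (hJ : Jᵀ = -J) (hJJ : J * J = -1)
    {c : Matrix m o C} {A : Matrix m m C} (hc : ∀ i a, c i a ∈ superCentralizer x px 1 1)
    (hA : ∀ i j, A i j ∈ superCentralizer x px 1 0)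
    (hcx : ∀ i a, c i a ∈ Submodule.span ℂ (Set.range x))
    (hAx : ∀ i a, A i a ∈ Submodule.span ℂ (Set.range x))
    (hAJ : Aᵀ * J.map (algebraMap ℂ C) = -(J.map (algebraMap ℂ C) * A)) :
    fromBlocks 0 (-(cᵀ * J.map (algebraMap ℂ C))) c A ^ (2 * (Fintype.card m + 1)) = 0 := by
  set J' := J.map (algebraMap ℂ C) with hJ'
  have hJ'T : J'ᵀ = -J' := by
    ext i j
    simpa [hJ'] using congrArg (algebraMap ℂ C) (congrFun (congrFun hJ i) j)
  set r := -(cᵀ * J') with hr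
  have hrmem : ∀ a i, r a i ∈ superCentralizer x px 1 1 := by
    intro a i
    rw [hr, Matrix.neg_apply, Matrix.mul_apply]
    refine neg_mem (Submodule.sum_mem _ fun k _ => ?_)
    have := mul_mem_superCentralizer (hc k a) (algebraMap_mem_superCentralizer (J k i))
    rwa [add_zero] at this
  have hrx : ∀ a i, r a i ∈ Submodule.span ℂ (Set.range x) := by
    intro a i
    rw [hr, Matrix.neg_apply, Matrix.mul_apply]
    refine neg_mem (Submodule.sum_mem _ fun k _ => ?_)
    rw [hJ', Matrix.map_apply, ← Algebra.commutes, ← Algebra.smul_def]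
    exact Submodule.smul_mem _ _ (hcx k a)
  have hspan : ∀ y ∈ Submodule.span ℂ (Set.range x), ∀ z ∈ Submodule.span ℂ (Set.range x),
      y * z ∈ F := by
    intro y hy z hz
    have h := Submodule.mul_mem_mul hy hz
    rw [Submodule.span_mul_span] at h
    refine (Submodule.span_le.2 ?_) h
    rintro _ ⟨_, ⟨i, rfl⟩, _, ⟨j, rfl⟩, rfl⟩
    exact hxF i j
  set ξ := fromBlocks 0 r c A with hξ
  set par : o ⊕ m → ZMod 2 := Sum.elim (fun _ => 0) (fun _ => 1) with hpar
  have hξmem : ∀ a b, ξ a b ∈ superCentralizer x px 1 (par a + par b) := by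
    rintro (a | a) (b | b)
    · exact zero_mem _
    · simpa [hξ, hpar] using hrmem a b
    · simpa [hξ, hpar] using hc a b
    · have : (1 + 1 : ZMod 2) = 0 := rfl
      simpa [hξ, hpar, this] using hA a b
  have hrc : r * c = 0 := by
    rw [hr, Matrix.neg_mul, neg_eq_zero, Matrix.mul_assoc]
    ext a b
    obtain rfl := Subsingleton.elim a b
    simp only [Matrix.mul_apply (M := cᵀ), Matrix.mul_apply (N := c), Finset.mul_sum]
    refine sum_sum_eq_zero_of_antisymm _ fun i j => ?_
    have h : J' i j = - J' j i := congrFun (congrFun hJ'T j) i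
    have h2 := supercommute hx (hc i a) (hc j a)
    rw [show (1 * 1 + 1 * 1 : ZMod 2) = 0 from rfl, sgn_zero, one_smul] at h2
    rw [transpose_apply, transpose_apply, h, neg_mul, mul_neg, hJ', Matrix.map_apply,
      Algebra.commutes, ← mul_assoc, h2, mul_assoc, ← Algebra.commutes]
  have hr2 : (1 : ZMod 2) + 1 = 0 := rfl
  have hSmem : ∀ i j, (c * r + A * A) i j ∈ superCentralizer x px 0 0 := by
    intro i j
    refine add_mem ?_ ?_
    · exact matrix_mul_mem_superCentralizer (p := 1) (p' := 1) (a := fun _ => 1) (b := fun _ => 0)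
        (c := fun _ => 1) (by simpa using hc) (by simpa using hrmem) i j
    · exact matrix_mul_mem_superCentralizer (p := 1) (p' := 1) (a := fun _ => 0) (b := fun _ => 0)
        (c := fun _ => 0) (by simpa using hA) (by simpa using hA) i j
  have hWmem : ∀ i a, (A * c) i a ∈ superCentralizer x px 0 1 := by
    exact matrix_mul_mem_superCentralizer (p := 1) (p' := 1) (a := fun _ => 0) (b := fun _ => 0)
        (c := fun _ => 1) (by simpa using hA) (by simpa using hc)
  have hUmem : ∀ a i, (r * A) a i ∈ superCentralizer x px 0 1 := by
    exact matrix_mul_mem_superCentralizer (p := 1) (p' := 1) (a := fun _ => 1) (b := fun _ => 0)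
        (c := fun _ => 0) (by simpa using hrmem) (by simpa using hA)
  have hPmem : ∀ i j, (A * c * (r * A)) i j ∈ superCentralizer x px 0 0 := by
    exact matrix_mul_mem_superCentralizer (p := 0) (p' := 0) (a := fun _ => 0) (b := fun _ => 1)
        (c := fun _ => 0) (by simpa using hWmem) (by simpa using hUmem)
  obtain ⟨S, hS⟩ := exists_matrix_map_center _ fun i j =>
    superCentralizer_zero_zero_mem_center hx hgen (hSmem i j)
  obtain ⟨P, hP⟩ := exists_matrix_map_center _ fun i j =>
    superCentralizer_zero_zero_mem_center hx hgen (hPmem i j)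
  set JK := J.map (algebraMap ℂ (Subalgebra.center ℂ C)) with hJK
  have hJKC : JK.map (algebraMap (Subalgebra.center ℂ C) C) = J' := rfl
  have hrT : rᵀ = J' * c := by
    ext i a
    rw [hr, transpose_apply, Matrix.neg_apply, Matrix.mul_apply, Matrix.mul_apply,
      ← Finset.sum_neg_distrib]
    refine Finset.sum_congr rfl fun k _ => ?_
    have h : J' k i = - J' i k := congrFun (congrFun hJ'T i) k
    rw [h, mul_neg, neg_neg, transpose_apply, hJ', Matrix.map_apply, Algebra.commutes]
  have hcrT : (c * r)ᵀ * J' = -(J' * (c * r)) := by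
    rw [transpose_mul_of_mem_superCentralizer hx hc hrmem,
      show (1 * 1 + 1 * 1 : ZMod 2) = 0 from rfl, sgn_zero, one_smul, Matrix.mul_assoc,
      ← neg_neg (cᵀ * J'), ← hr, ← Matrix.mul_assoc, Matrix.mul_neg, ← Matrix.neg_mul]
    rw [hrT, Matrix.neg_mul]
  have hAAT : (A * A)ᵀ * J' = -(J' * (A * A)) := by
    rw [transpose_mul_of_mem_superCentralizer hx hA hA,
      show (1 * 1 + 0 * 0 : ZMod 2) = 1 from rfl, sgn_one, neg_one_smul, Matrix.neg_mul,
      Matrix.mul_assoc, hAJ, Matrix.mul_neg, ← Matrix.mul_assoc, hAJ, Matrix.neg_mul, neg_neg,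
      Matrix.mul_assoc]
  have hsq : ξ ^ 2 = fromBlocks 0 (r * A) (A * c)
      (S.map (algebraMap (Subalgebra.center ℂ C) C)) := by
    rw [pow_two, hξ, fromBlocks_multiply, hrc, hS]
    simp
  rw [pow_mul, hsq]
  refine pow_eq_zero_of_skew (J := JK) (P := P) ?_ ?_ ?_ ?_ hP.symm ?_ ?_ ?_ ?_
  · rw [hJK, ← transpose_map, hJ, Matrix.map_neg _ (map_neg _)]
    rfl
  · rw [hJK, ← Matrix.map_mul, hJJ, Matrix.map_neg _ (map_neg _),
      Matrix.map_one _ (map_zero _) (map_one _)]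
    rfl
  · apply Matrix.map_injective centerAlgebra_algebraMap_injective
    change (Sᵀ * JK).map (algebraMap (Subalgebra.center ℂ C) C) =
        -(JK * S).map (algebraMap (Subalgebra.center ℂ C) C)
    rw [Matrix.map_mul, Matrix.map_mul, transpose_map, hS, hJKC,
      transpose_add, Matrix.add_mul, Matrix.mul_add, hcrT, hAAT, neg_add]
  · intro i j
    apply isNilpotent_of_algebraMap_center
    rw [← Matrix.map_apply (f := algebraMap _ C), hS]
    refine hF _ (add_mem ?_ ?_)
    · rw [Matrix.mul_apply]
      exact Submodule.sum_mem _ fun k _ => hspan _ (hcx _ _) _ (hrx _ _)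
    · rw [Matrix.mul_apply]
      exact Submodule.sum_mem _ fun k _ => hspan _ (hAx _ _) _ (hAx _ _)
  · rw [hJKC, transpose_mul_of_mem_superCentralizer hx hA hc,
      show (1 * 1 + 0 * 1 : ZMod 2) = 1 from rfl, sgn_one, neg_one_smul, Matrix.neg_mul (cᵀ * Aᵀ),
      neg_neg, Matrix.mul_assoc cᵀ Aᵀ, hAJ, hr, Matrix.mul_neg, Matrix.neg_mul, Matrix.mul_assoc]
  · intro i j a b
    have := supercommute hx (hWmem i a) (hWmem j b)
    rwa [show (0 * 0 + 1 * 1 : ZMod 2) = 1 from rfl, sgn_one, neg_one_smul] at this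
  · intro t k i a b l
    have hmem := matrix_pow_mem_superCentralizer (x := x) (px := px) (p := 0) (a := par)
      (M := fromBlocks 0 (r * A) (A * c)
        ((S + t • JK).map (algebraMap (Subalgebra.center ℂ C) C))) ?_ k (Sum.inl a) (Sum.inr i)
    · have := supercommute hx hmem (hWmem l b)
      simp only [hpar, Sum.elim_inl, Sum.elim_inr, mul_zero, zero_add, mul_one, sgn_one,
        neg_one_smul] at this
      exact this
    · rintro (a | a) (b | b)
      · exact zero_mem _
      · simpa [hpar] using hUmem a b
      · simpa [hpar] using hWmem a b
      · have e : (S + t • JK).map (algebraMap (Subalgebra.center ℂ C) C) =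
            (c * r + A * A) + t • J' := by
          rw [← hS, ← hJKC]
          rfl
        rw [fromBlocks_apply₂₂, e, hpar, Sum.elim_inr, Sum.elim_inr, hr2]
        exact add_mem (hSmem a b) (Submodule.smul_mem _ _ (algebraMap_mem_superCentralizer _))
  · intro k
    rw [← hsq, ← pow_mul, show 2 * (k + 1) = 2 * k + 1 + 1 by ring]
    have hodd : ∀ i j, (ξ ^ (2 * k + 1)) i j ∈ superCentralizer x px 1 (par i + par j) := by
      intro i j
      have := matrix_pow_mem_superCentralizer hξmem (2 * k + 1) i j
      have e : (((2 * k + 1 : ℕ) : ZMod 2)) * 1 = 1 := by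
        push_cast
        rw [show (2 : ZMod 2) = 0 from rfl]
        ring
      rwa [e] at this
    have h := sum_sgn_smul_diag_mul hx hodd hξmem
    rw [← pow_succ, ← pow_succ'] at h
    have h2 : (2 : ℂ) • ∑ i, sgn (par i) • (ξ ^ (2 * k + 1 + 1)) i i = 0 := by
      rw [two_smul]
      nth_rw 1 [h]
      exact neg_add_cancel _
    have h3 := (smul_eq_zero.1 h2).resolve_left two_ne_zero
    rw [Fintype.sum_sum_type] at h3
    simp only [hpar, Sum.elim_inl, Sum.elim_inr, sgn_zero, sgn_one, one_smul, neg_one_smul,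
      Finset.sum_neg_distrib] at h3
    rw [← neg_eq_zero, neg_sub]
    simpa [sub_eq_add_neg, Matrix.trace, toBlocks₁₁, toBlocks₂₂] using h3

end Graded

section SuperExterior

variable {k : ℕ} (px : Fin k → ZMod 2)

/-- The sign picked up when the `i`-th generator moves past the generators in `S` preceding it. -/
noncomputable def insertionSign (i : Fin k) (S : Finset (Fin k)) : ℂ :=
  ∏ j ∈ S with j < i, sgn (1 + px i * px j)

/-- Left multiplication by the `i`-th generator on the span of square-free ordered monomials in
generators of parities `px` that pairwise commute up to the opposite of the super sign. -/
noncomputable def superGenerator (i : Fin k) : Matrix (Finset (Fin k)) (Finset (Fin k)) ℂ :=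
  of fun T S => if i ∈ T ∧ S = T.erase i then insertionSign px i S else 0

theorem insertionSign_erase {i j : Fin k} {T : Finset (Fin k)} (hj : j ∈ T) :
    insertionSign px i T =
      (if j < i then sgn (1 + px i * px j) else 1) * insertionSign px i (T.erase j) := by
  simp only [insertionSign, Finset.prod_filter]
  rw [Finset.mul_prod_erase _ (fun j => if j < i then sgn (1 + px i * px j) else 1) hj]

theorem superGenerator_mul_apply (i : Fin k) (N : Matrix (Finset (Fin k)) (Finset (Fin k)) ℂ)
    (T S : Finset (Fin k)) : (superGenerator px i * N) T S =
      if i ∈ T then insertionSign px i (T.erase i) * N (T.erase i) S else 0 := by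
  rw [Matrix.mul_apply]
  by_cases h : i ∈ T <;> simp [superGenerator, h]

theorem superGenerator_mul_superGenerator (i j : Fin k) :
    superGenerator px i * superGenerator px j =
      sgn (1 + px i * px j) • (superGenerator px j * superGenerator px i) := by
  ext T S
  rw [Matrix.smul_apply, superGenerator_mul_apply, superGenerator_mul_apply]
  simp only [superGenerator, of_apply, smul_eq_mul]
  by_cases h : i ∈ T ∧ j ∈ T ∧ i ≠ j ∧ S = (T.erase i).erase j
  · obtain ⟨hi, hj, hij, rfl⟩ := h
    have hji : j ∈ T.erase i := Finset.mem_erase.2 ⟨hij.symm, hj⟩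
    have hij' : i ∈ T.erase j := Finset.mem_erase.2 ⟨hij, hi⟩
    have hcomm : (T.erase j).erase i = (T.erase i).erase j := Finset.erase_right_comm
    rw [if_pos hi, if_pos hj, if_pos ⟨hji, rfl⟩, if_pos ⟨hij', hcomm.symm⟩,
      insertionSign_erase px hji, insertionSign_erase px hij', hcomm, mul_comm (px j)]
    have hs := sgn_mul_self (1 + px i * px j)
    rcases lt_or_gt_of_ne hij with h | h
    · rw [if_neg h.not_gt, if_pos h]
      linear_combination (-insertionSign px i ((T.erase i).erase j)
        * insertionSign px j ((T.erase i).erase j)) * hs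
    · rw [if_pos h, if_neg h.not_gt]
      ring
  · have h' : ¬ (i ∈ T ∧ j ∈ T ∧ i ≠ j ∧ S = (T.erase j).erase i) := by
      rwa [Finset.erase_right_comm]
    have e1 : ∀ c d : ℂ, (if i ∈ T then c * (if j ∈ T.erase i ∧ S = (T.erase i).erase j
        then d else 0) else 0) = 0 := by
      intro c d
      split_ifs with h1 h2
      · exact absurd ⟨h1, Finset.mem_of_mem_erase h2.1, (Finset.ne_of_mem_erase h2.1).symm, h2.2⟩ h
      · simp
      · rfl
    have e2 : ∀ c d : ℂ, (if j ∈ T then c * (if i ∈ T.erase j ∧ S = (T.erase j).erase i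
        then d else 0) else 0) = 0 := by
      intro c d
      split_ifs with h1 h2
      · exact absurd ⟨Finset.mem_of_mem_erase h2.1, h1, Finset.ne_of_mem_erase h2.1, h2.2⟩ h'
      · simp
      · rfl
    rw [e1, e2, mul_zero]

/-- The coefficient of the ordered monomial in a product of distinct generators. -/
noncomputable def listSign : List (Fin k) → ℂ
  | [] => 1
  | i :: l => insertionSign px i l.toFinset * listSign l

theorem prod_superGenerator_apply_empty (l : List (Fin k)) (T : Finset (Fin k)) :
    (l.map (superGenerator px)).prod T ∅ =
      if l.Nodup ∧ l.toFinset = T then listSign px l else 0 := by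
  induction l generalizing T with
  | nil => simp [listSign, Matrix.one_apply, eq_comm]
  | cons i l ih =>
    rw [List.map_cons, List.prod_cons, superGenerator_mul_apply, ih, listSign]
    by_cases hi : i ∈ T
    · by_cases h : l.Nodup ∧ l.toFinset = T.erase i
      · have h2 : (i :: l).Nodup ∧ (i :: l).toFinset = T := by
          refine ⟨List.nodup_cons.2 ⟨fun hil => ?_, h.1⟩, ?_⟩
          · rw [← List.mem_toFinset, h.2] at hil
            exact Finset.notMem_erase _ _ hil
          · rw [List.toFinset_cons, h.2, Finset.insert_erase hi]
        rw [if_pos hi, if_pos h, if_pos h2, h.2]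
      · have h2 : ¬ ((i :: l).Nodup ∧ (i :: l).toFinset = T) := by
          rintro ⟨hnd, rfl⟩
          refine h ⟨(List.nodup_cons.1 hnd).2, ?_⟩
          rw [List.toFinset_cons, Finset.erase_insert]
          simpa using (List.nodup_cons.1 hnd).1
        rw [if_neg h2, if_neg h, mul_zero, ite_self]
    · have h2 : ¬ ((i :: l).Nodup ∧ (i :: l).toFinset = T) := by
        rintro ⟨_, rfl⟩
        simp at hi
      rw [if_neg hi, if_neg h2]

theorem listSign_ofFn {m : ℕ} (f : Fin m → Fin k) (hf : Function.Injective f) :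
    listSign px (List.ofFn f) =
      ∏ a, ∏ b, if a < b ∧ f b < f a then sgn (1 + px (f a) * px (f b)) else 1 := by
  induction m with
  | zero => simp [listSign]
  | succ m ih =>
    rw [List.ofFn_succ, listSign, ih (fun i => f i.succ) (hf.comp (Fin.succ_injective m)), Fin.prod_univ_succ]
    congr 1
    · have himg : (List.ofFn fun i : Fin m => f i.succ).toFinset =
          Finset.univ.image fun i : Fin m => f i.succ := by
        ext
        simp [List.mem_ofFn]
      rw [insertionSign, Finset.prod_filter, himg,
        Finset.prod_image fun a _ b _ h => Fin.succ_injective m (hf h), Fin.prod_univ_succ]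
      simp
    · refine Finset.prod_congr rfl fun a _ => ?_
      rw [Fin.prod_univ_succ]
      simp

theorem listSign_perm (σ : Equiv.Perm (Fin k)) :
    listSign px (List.ofFn σ) = ((Equiv.Perm.sign σ : ℤ) : ℂ) * superSign σ px := by
  rw [listSign_ofFn px σ σ.injective, superSign, Equiv.Perm.sign_eq_prod_prod_Ioi]
  have h : ∀ a b : ZMod 2, a * b = 1 ↔ a = 1 ∧ b = 1 := by decide
  have hs : ∀ a b : ZMod 2, sgn (1 + a * b) = -(if a = 1 ∧ b = 1 then -1 else 1) := by
    intro a b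
    rw [sgn_add, sgn_one, sgn, neg_one_mul]
    simp only [h]
  rw [← Finset.prod_const, Finset.prod_filter, Fintype.prod_prod_type]
  push_cast
  rw [← Finset.prod_mul_distrib]
  refine Finset.prod_congr rfl fun a _ => ?_
  rw [← Finset.filter_lt_eq_Ioi, Finset.prod_filter, ← Finset.prod_mul_distrib]
  refine Finset.prod_congr rfl fun b _ => ?_
  by_cases hab : a < b
  · rcases lt_or_gt_of_ne (σ.injective.ne hab.ne) with h1 | h1
    · simp [hab, h1, h1.not_gt]
    · simp [hab, h1, h1.not_gt, hs]
      split_ifs <;> simp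
  · simp [hab]

/-- Matrices raising the cardinality of the index by at least `d`. -/
def cardFiltration (k d : ℕ) : Submodule ℂ (Matrix (Finset (Fin k)) (Finset (Fin k)) ℂ) where
  carrier := {y | ∀ T S, T.card < S.card + d → y T S = 0}
  add_mem' ha hb T S h := by rw [Matrix.add_apply, ha T S h, hb T S h, add_zero]
  zero_mem' _ _ _ := rfl
  smul_mem' c y hy T S h := by rw [Matrix.smul_apply, hy T S h, smul_zero]

theorem mul_mem_cardFiltration {d e : ℕ} {y z : Matrix (Finset (Fin k)) (Finset (Fin k)) ℂ}
    (hy : y ∈ cardFiltration k d) (hz : z ∈ cardFiltration k e) :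
    y * z ∈ cardFiltration k (d + e) := by
  intro T S h
  rw [Matrix.mul_apply]
  refine Finset.sum_eq_zero fun R _ => ?_
  by_cases hR : T.card < R.card + d
  · rw [hy T R hR, zero_mul]
  · rw [hz R S (by omega), mul_zero]

theorem isNilpotent_of_mem_cardFiltration {y : Matrix (Finset (Fin k)) (Finset (Fin k)) ℂ}
    (hy : y ∈ cardFiltration k 1) : IsNilpotent y := by
  have hpow : ∀ n, y ^ n ∈ cardFiltration k n := by
    intro n
    induction n with
    | zero =>
      intro T S h
      rw [pow_zero, Matrix.one_apply_ne]
      rintro rfl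
      omega
    | succ n ih => exact pow_succ y n ▸ mul_mem_cardFiltration ih hy
  refine ⟨k + 1, ?_⟩
  ext T S
  refine hpow (k + 1) T S ?_
  have := T.card_le_univ
  rw [Fintype.card_fin] at this
  omega

theorem superGenerator_mem_cardFiltration (i : Fin k) :
    superGenerator px i ∈ cardFiltration k 1 := by
  intro T S h
  rw [superGenerator, of_apply, if_neg]
  rintro ⟨hi, rfl⟩
  rw [Finset.card_erase_add_one hi] at h
  exact lt_irrefl _ h

theorem cardFiltration_two_le_one : cardFiltration k 2 ≤ cardFiltration k 1 :=
  fun _ hy T S h => hy T S (by omega)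

end SuperExterior

section Extraction

theorem sum_smul_pow_apply {r ι C : Type*} [Fintype r] [DecidableEq r] [Fintype ι] [Ring C]
    [Algebra ℂ C] (x : ι → C) (X : ι → Matrix r r ℂ) (N : ℕ) (a b : r) :
    ((of fun a b => ∑ i, X i a b • x i : Matrix r r C) ^ N) a b =
      ∑ f : Fin N → ι, (List.ofFn fun i => X (f i)).prod a b • (List.ofFn fun i => x (f i)).prod := by
  induction N generalizing a b with
  | zero =>
    by_cases h : a = b <;> simp [h]
  | succ N ih =>
    rw [pow_succ', Matrix.mul_apply, ← (Fin.consEquiv fun _ => ι).sum_comp,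
      Fintype.sum_prod_type]
    simp only [Fin.consEquiv_apply, List.ofFn_succ, List.prod_cons, Fin.cons_zero, Fin.cons_succ,
      ih, of_apply, Finset.sum_mul_sum, smul_mul_smul_comm, Matrix.mul_apply, Finset.sum_smul]
    rw [Finset.sum_comm]
    refine Finset.sum_congr rfl fun i _ => ?_
    rw [Finset.sum_comm]

end Extraction

section Osp

/-- The symplectic block of `Bmat`. -/
noncomputable def symplecticForm (n : ℕ) : Matrix (Fin (2 * n)) (Fin (2 * n)) ℂ :=
  of fun i j => Bmat n (Sum.inr i) (Sum.inr j)

theorem symplecticForm_transpose (n : ℕ) : (symplecticForm n)ᵀ = -symplecticForm n := by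
  ext i j
  simp only [symplecticForm, transpose_apply, of_apply, Matrix.neg_apply, Bmat]
  have := i.2
  split_ifs <;> first | omega | simp

theorem symplecticForm_mul_self (n : ℕ) : symplecticForm n * symplecticForm n = -1 := by
  ext i j
  rw [Matrix.mul_apply, Matrix.neg_apply, Matrix.one_apply]
  simp only [symplecticForm, of_apply, Bmat]
  have hi := i.2
  have hj := j.2
  by_cases h : i.val < n
  · rw [Finset.sum_eq_single (⟨i.val + n, by omega⟩ : Fin (2 * n))]
    · simp only [Fin.ext_iff]
      split_ifs <;> first | omega | simp
    · intro b _ hb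
      rw [Ne, Fin.ext_iff] at hb
      simp only at hb
      rw [if_neg (by omega), if_neg (by omega), zero_mul]
    · simp
  · rw [Finset.sum_eq_single (⟨i.val - n, by omega⟩ : Fin (2 * n))]
    · simp only [Fin.ext_iff]
      split_ifs <;> first | omega | simp
    · intro b _ hb
      rw [Ne, Fin.ext_iff] at hb
      simp only at hb
      have := b.2
      rw [if_neg (by omega), if_neg (by omega), zero_mul]
    · simp

variable {n : ℕ} {X : Matrix (Idx 1 (2 * n)) (Idx 1 (2 * n)) ℂ} {ε : ZMod 2}

theorem ospMem.sum_mul_Bmat (hX : ospMem X ε) (a b : Idx 1 (2 * n)) :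
    ∑ i, X i a * Bmat n i b + sgn (ε * ipar a) * ∑ j, Bmat n a j * X j b = 0 := by
  have hpar : ∀ c : Idx 1 (2 * n), VHasParity (Pi.single c 1 : Idx 1 (2 * n) → ℂ) (ipar c) := by
    intro c i hi
    rw [Pi.single_apply, if_neg]
    rintro rfl
    exact hi rfl
  have := hX.2 _ _ _ _ (hpar a) (hpar b)
  simpa [Bform, Pi.single_apply] using this

theorem ospMem.apply_inl_inl (hX : ospMem X ε) (a b : Fin 1) : X (Sum.inl a) (Sum.inl b) = 0 := by
  obtain rfl := Subsingleton.elim a 0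
  obtain rfl := Subsingleton.elim b 0
  have := hX.sum_mul_Bmat (Sum.inl 0) (Sum.inl 0)
  simp only [Fintype.sum_sum_type, Bmat, ipar, mul_zero, sgn] at this
  simp at this
  exact this

theorem ospMem.apply_inl_inr (hX : ospMem X ε) (a : Fin 1) (i : Fin (2 * n)) :
    X (Sum.inl a) (Sum.inr i) = -∑ l, X (Sum.inr l) (Sum.inl a) * symplecticForm n l i := by
  obtain rfl := Subsingleton.elim a 0
  have := hX.sum_mul_Bmat (Sum.inl 0) (Sum.inr i)
  rw [Fintype.sum_sum_type, Fintype.sum_sum_type] at this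
  simp only [Bmat, ipar, mul_zero, sgn] at this
  simp at this
  simp only [symplecticForm, of_apply, Bmat, mul_ite, mul_neg, mul_one, mul_zero]
  linear_combination this

theorem ospMem.sum_apply_inr_inr (hX : ospMem X ε) (i j : Fin (2 * n)) :
    ∑ l, X (Sum.inr l) (Sum.inr i) * symplecticForm n l j =
      -∑ l, symplecticForm n i l * X (Sum.inr l) (Sum.inr j) := by
  have h01 : ε = 0 ∨ ε = 1 := (by decide : ∀ δ : ZMod 2, δ = 0 ∨ δ = 1) ε
  rcases h01 with rfl | rfl
  · have := hX.sum_mul_Bmat (Sum.inr i) (Sum.inr j)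
    rw [Fintype.sum_sum_type, Fintype.sum_sum_type, zero_mul] at this
    simp [sgn] at this
    simp only [symplecticForm, of_apply]
    simp only [Bmat] at this ⊢
    linear_combination this
  · have h0 : ∀ i j, X (Sum.inr i) (Sum.inr j) = 0 := fun i j => hX.1 _ _ (by simp [ipar])
    simp [h0]

end Osp

section Main

variable {k : ℕ} (px : Fin k → ZMod 2)

/-- The algebra generated by the matrices `superGenerator px i`. -/
abbrev SuperExterior : Subalgebra ℂ (Matrix (Finset (Fin k)) (Finset (Fin k)) ℂ) :=
  Algebra.adjoin ℂ (Set.range (superGenerator px))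

/-- The generators of `SuperExterior px`. -/
noncomputable def SuperExterior.gen (i : Fin k) : SuperExterior px :=
  ⟨superGenerator px i, Algebra.subset_adjoin ⟨i, rfl⟩⟩

instance : IsTopologicalRing (SuperExterior px) :=
  inferInstanceAs (IsTopologicalRing (SuperExterior px).toSubring)

theorem SuperExterior.adjoin_gen : Algebra.adjoin ℂ (Set.range (SuperExterior.gen px)) = ⊤ := by
  rw [← Algebra.adjoin_adjoin_coe_preimage]
  congr 1
  ext y
  simp [SuperExterior.gen, Subtype.ext_iff]

theorem SuperExterior.prod_gen (l : List (Fin k)) :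
    (((l.map (SuperExterior.gen px)).prod : SuperExterior px) :
      Matrix (Finset (Fin k)) (Finset (Fin k)) ℂ) = (l.map (superGenerator px)).prod := by
  induction l with
  | nil => rfl
  | cons i l ih => rw [List.map_cons, List.prod_cons, MulMemClass.coe_mul, ih]; rfl

theorem SuperExterior.gen_mul_gen (i j : Fin k) :
    SuperExterior.gen px i * SuperExterior.gen px j =
      sgn (1 + px i * px j) • (SuperExterior.gen px j * SuperExterior.gen px i) :=
  Subtype.ext (superGenerator_mul_superGenerator px i j)

theorem SuperExterior.isNilpotent_of_mem_comap_cardFiltration {y : SuperExterior px}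
    (hy : y ∈ (cardFiltration k 1).comap (SuperExterior px).val.toLinearMap) : IsNilpotent y :=
  (IsNilpotent.map_iff (f := (SuperExterior px).val) Subtype.val_injective).1
    (isNilpotent_of_mem_cardFiltration hy)

theorem SuperExterior.gen_mul_gen_mem_comap_cardFiltration (i j : Fin k) :
    SuperExterior.gen px i * SuperExterior.gen px j ∈
      (cardFiltration k 1).comap (SuperExterior px).val.toLinearMap :=
  cardFiltration_two_le_one (mul_mem_cardFiltration
    (superGenerator_mem_cardFiltration px i) (superGenerator_mem_cardFiltration px j))

/-- The generic combination of the matrices `X i`, with coefficients in `SuperExterior px`. -/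
noncomputable def genericMatrix {p q : ℕ} (X : Fin k → Matrix (Idx p q) (Idx p q) ℂ) :
    Matrix (Idx p q) (Idx p q) (SuperExterior px) :=
  of fun a b => ∑ i, X i a b • SuperExterior.gen px i

variable {px}

theorem genericMatrix_apply {p q : ℕ} (X : Fin k → Matrix (Idx p q) (Idx p q) ℂ)
    (a b : Idx p q) : genericMatrix px X a b = ∑ i, X i a b • SuperExterior.gen px i :=
  rfl

theorem genericMatrix_mem_superCentralizer {p q : ℕ} {X : Fin k → Matrix (Idx p q) (Idx p q) ℂ}
    (hX : ∀ i, HasParity (X i) (px i)) (a b : Idx p q) :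
    genericMatrix px X a b ∈
      superCentralizer (SuperExterior.gen px) px 1 (ipar a + ipar b) := by
  rw [genericMatrix_apply]
  refine Submodule.sum_mem _ fun i _ => ?_
  by_cases h : ipar a = ipar b + px i
  · have e : ipar a + ipar b = px i := by
      rw [h, add_right_comm, CharTwo.add_self_eq_zero, zero_add]
    rw [e]
    exact Submodule.smul_mem _ _ (mem_superCentralizer_generator i)
  · rw [hX i a b h, zero_smul]
    exact zero_mem _

theorem genericMatrix_mem_span {p q : ℕ} (X : Fin k → Matrix (Idx p q) (Idx p q) ℂ)
    (a b : Idx p q) :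
    genericMatrix px X a b ∈ Submodule.span ℂ (Set.range (SuperExterior.gen px)) := by
  rw [genericMatrix_apply]
  exact Submodule.sum_mem _ fun i _ =>
    Submodule.smul_mem _ _ (Submodule.subset_span (Set.mem_range_self i))

theorem skewPoly_eq_zero_of_pow_eq_zero {p q : ℕ} (X : Fin k → Matrix (Idx p q) (Idx p q) ℂ)
    (h : genericMatrix px X ^ k = 0) : skewPoly X px = 0 := by
  ext a b
  have h1 := sum_smul_pow_apply (SuperExterior.gen px) X k a b
  rw [← genericMatrix, h, Matrix.zero_apply] at h1
  have h2 := congrArg (fun y : SuperExterior px =>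
    (y : Matrix (Finset (Fin k)) (Finset (Fin k)) ℂ) Finset.univ ∅) h1
  simp only [ZeroMemClass.coe_zero, Matrix.zero_apply, AddSubmonoidClass.coe_finsetSum,
    Matrix.sum_apply, SetLike.val_smul, Matrix.smul_apply, smul_eq_mul] at h2
  rw [skewPoly, Matrix.sum_apply, Matrix.zero_apply, h2]
  refine Fintype.sum_of_injective (fun σ : Equiv.Perm (Fin k) => (σ : Fin k → Fin k))
    DFunLike.coe_injective _ _ (fun f hf => ?_) fun σ => ?_
  all_goals
    rw [← Function.comp_def (SuperExterior.gen px), ← List.map_ofFn, SuperExterior.prod_gen,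
      prod_superGenerator_apply_empty]
  · rw [if_neg, mul_zero]
    rintro ⟨hnd, -⟩
    have hinj := List.nodup_ofFn.1 hnd
    exact hf ⟨Equiv.ofBijective f (Finite.injective_iff_bijective.1 hinj), rfl⟩
  · rw [if_pos, listSign_perm, Matrix.smul_apply, smul_eq_mul, mul_comm]
    · rfl
    · refine ⟨List.nodup_ofFn.2 σ.injective, ?_⟩
      ext i
      simpa [List.mem_ofFn] using σ.surjective i

variable {n : ℕ} {X : Fin k → Matrix (Idx 1 (2 * n)) (Idx 1 (2 * n)) ℂ}

theorem genericMatrix_eq_fromBlocks (hX : ∀ i, ospMem (X i) (px i)) :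
    genericMatrix px X = fromBlocks 0
      (-((genericMatrix px X).toBlocks₂₁ᵀ *
        (symplecticForm n).map (algebraMap ℂ (SuperExterior px))))
      (genericMatrix px X).toBlocks₂₁ (genericMatrix px X).toBlocks₂₂ := by
  conv_lhs => rw [← fromBlocks_toBlocks (genericMatrix px X)]
  congr 1
  · ext1 a b
    change genericMatrix px X (Sum.inl a) (Sum.inl b) = 0
    simp only [genericMatrix_apply, (hX _).apply_inl_inl, zero_smul, Finset.sum_const_zero]
  · ext1 a j
    change genericMatrix px X (Sum.inl a) (Sum.inr j) =
      -∑ l, genericMatrix px X (Sum.inr l) (Sum.inl a) * _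
    simp only [genericMatrix_apply, (hX _).apply_inl_inr, Matrix.map_apply, ← Algebra.commutes,
      ← Algebra.smul_def, Finset.smul_sum, neg_smul, Finset.sum_smul, Finset.sum_neg_distrib,
      smul_smul]
    rw [Finset.sum_comm]
    simp only [mul_comm]

theorem genericMatrix_toBlocks₂₂_transpose_mul (hX : ∀ i, ospMem (X i) (px i)) :
    (genericMatrix px X).toBlocks₂₂ᵀ *
        (symplecticForm n).map (algebraMap ℂ (SuperExterior px)) =
      -((symplecticForm n).map (algebraMap ℂ (SuperExterior px)) *
        (genericMatrix px X).toBlocks₂₂) := by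
  ext1 i j
  change ∑ l, genericMatrix px X (Sum.inr l) (Sum.inr i) * _ =
    -∑ l, _ * genericMatrix px X (Sum.inr l) (Sum.inr j)
  simp only [genericMatrix_apply, Matrix.map_apply, ← Algebra.commutes, ← Algebra.smul_def,
    Finset.smul_sum, smul_smul]
  refine Finset.sum_comm.trans (Eq.trans ?_ (congrArg Neg.neg Finset.sum_comm))
  rw [← Finset.sum_neg_distrib]
  refine Finset.sum_congr rfl fun s _ => ?_
  rw [← Finset.sum_smul, ← Finset.sum_smul, ← neg_smul, ← (hX s).sum_apply_inr_inr]
  simp only [mul_comm]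

end Main

/-- For every `k ≥ 4n+2`, `𝒜_k` vanishes on homogeneous elements of `osp(1,2n)`. -/
theorem skewPoly_eq_zero_of_ge_osp (n : ℕ) (hn : 1 ≤ n) (k : ℕ) (hk : 4*n+2 ≤ k)
    (X : Fin k → Matrix (Idx 1 (2*n)) (Idx 1 (2*n)) ℂ)
    (px : Fin k → ZMod 2) (hX : ∀ i, ospMem (X i) (px i)) :
    skewPoly X px = 0 := by
  apply skewPoly_eq_zero_of_pow_eq_zero
  have hmem := genericMatrix_mem_superCentralizer fun i => (hX i).1
  have hspan := genericMatrix_mem_span (px := px) X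
  have hpow := fromBlocks_pow_eq_zero (SuperExterior.gen_mul_gen px)
    (SuperExterior.adjoin_gen px) _
    (fun _ => SuperExterior.isNilpotent_of_mem_comap_cardFiltration px)
    (SuperExterior.gen_mul_gen_mem_comap_cardFiltration px)
    (symplecticForm_transpose n) (symplecticForm_mul_self n)
    (c := (genericMatrix px X).toBlocks₂₁) (A := (genericMatrix px X).toBlocks₂₂)
    (fun i a => hmem (Sum.inr i) (Sum.inl a)) (fun i j => hmem (Sum.inr i) (Sum.inr j))
    (fun i a => hspan (Sum.inr i) (Sum.inl a)) (fun i j => hspan (Sum.inr i) (Sum.inr j))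
    (genericMatrix_toBlocks₂₂_transpose_mul hX)
  rw [← genericMatrix_eq_fromBlocks hX, Fintype.card_fin] at hpow
  have hpow' : genericMatrix px X ^ (2 * (2 * n + 1)) = 0 := by
    convert hpow
    rfl
  exact pow_eq_zero_of_le (by omega) hpow'
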